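/- arXiv:1503.02478 — 6 statements merged into one kernel-verified Lean document; each statement's English description precedes it below -/
import Mathlib

section
/- For every ε > 0 there exists r₀ > 0 such that for every z ∈ 𝒮 with Re z ≥ r₀ the following holds: if T : L²(ℝ,ℂ) → L²(ℝ,ℂ) is a bounded linear operator such that for every f ∈ L²(ℝ,ℂ) one has (T f)(x) = ∫_ℝ R_z(x,y)·f(y) dy for almost every x ∈ ℝ, then (1−ε)·Re z/√(1−(Im z)²) ≤ ‖T‖ ≤ 4·(1+ε)·Re z/(1−|Im z|). -/
open MeasureTheory Complex Set

noncomputable def kp (z : ℂ) : ℂ := (Complex.I - z) ^ (1/2 : ℂ)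
noncomputable def km (z : ℂ) : ℂ := (-Complex.I - z) ^ (1/2 : ℂ)

def SigmaSet : Set ℂ := {z : ℂ | 0 ≤ z.re ∧ (z.im = 1 ∨ z.im = -1)}

def Sset : Set ℂ := {z : ℂ | 0 ≤ z.re ∧ |z.im| < 1}

noncomputable def Rker (z : ℂ) (x y : ℝ) : ℂ :=
  if 0 ≤ x ∧ y ≤ 0 then Complex.exp (-(kp z) * (x : ℂ) + km z * (y : ℂ)) / (kp z + km z)
  else if x ≤ 0 ∧ 0 ≤ y then Complex.exp (km z * (x : ℂ) - kp z * (y : ℂ)) / (kp z + km z)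
  else if 0 ≤ x then
    Complex.exp (-(kp z) * (|x - y| : ℝ)) / (2 * kp z)
      + (kp z - km z) * Complex.exp (-(kp z) * ((x : ℂ) + (y : ℂ))) / (2 * kp z * (kp z + km z))
  else
    Complex.exp (-(km z) * (|x - y| : ℝ)) / (2 * km z)
      - (kp z - km z) * Complex.exp (km z * ((x : ℂ) + (y : ℂ))) / (2 * km z * (kp z + km z))


theorem Lp_two_enorm_sq {α : Type*} [MeasurableSpace α] {μ : Measure α} (f : Lp ℂ 2 μ) :
    ‖f‖ₑ ^ 2 = ∫⁻ x, ‖f x‖ₑ ^ 2 ∂μ := by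
  have h := eLpNorm_nnreal_pow_eq_lintegral (f := f) (μ := μ) (p := 2) (by norm_num)
  rw [Lp.enorm_def]
  simpa using h

/-- Cauchy–Schwarz inequality with respect to a weight. -/
theorem lintegral_mul_sq_le {α : Type*} [MeasurableSpace α] {μ : Measure α}
    {w g : α → ENNReal} (hw : Measurable w) (hg : Measurable g) :
    (∫⁻ y, w y * g y ∂μ) ^ 2 ≤ (∫⁻ y, w y ∂μ) * ∫⁻ y, w y * g y ^ 2 ∂μ := by
  have key := ENNReal.lintegral_mul_le_Lp_mul_Lq μ Real.HolderConjugate.two_two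
    (f := fun y => w y ^ (1 / 2 : ℝ)) (g := fun y => w y ^ (1 / 2 : ℝ) * g y)
    (hw.pow_const _).aemeasurable ((hw.pow_const _).mul hg).aemeasurable
  have hsq (t : ENNReal) : t ^ (1 / 2 : ℝ) * t ^ (1 / 2 : ℝ) = t := by
    rw [← ENNReal.rpow_add_of_nonneg _ _ (by norm_num) (by norm_num)]; norm_num
  simp only [Pi.mul_apply, ← mul_assoc, hsq, ENNReal.rpow_two, mul_pow] at key
  have hsq' (t : ENNReal) : (t ^ (1 / 2 : ℝ)) ^ 2 = t := by rw [sq, hsq]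
  simp only [hsq'] at key
  calc _ ≤ _ := pow_le_pow_left' key 2
    _ = _ := by rw [mul_pow, hsq', hsq']

/-- The Schur test. -/
theorem norm_le_of_schur {α : Type*} [MeasurableSpace α] {μ : Measure α} [SFinite μ]
    {K : α → α → ℂ} (hK : Measurable (Function.uncurry K)) {M : ℝ} (hM : 0 ≤ M)
    (hrow : ∀ᵐ x ∂μ, ∫⁻ y, ‖K x y‖ₑ ∂μ ≤ ENNReal.ofReal M)
    (hcol : ∀ᵐ y ∂μ, ∫⁻ x, ‖K x y‖ₑ ∂μ ≤ ENNReal.ofReal M)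
    (T : Lp ℂ 2 μ →L[ℂ] Lp ℂ 2 μ)
    (hT : ∀ f : Lp ℂ 2 μ, ∀ᵐ x ∂μ, (T f : α → ℂ) x = ∫ y, K x y * f y ∂μ) :
    ‖T‖ ≤ M := by
  refine T.opNorm_le_bound hM fun f => ?_
  have hf : Measurable fun y => ‖f y‖ₑ := (Lp.stronglyMeasurable f).measurable.enorm
  have hKx (x : α) : Measurable fun y => ‖K x y‖ₑ := (hK.comp measurable_prodMk_left).enorm
  have hint : ‖T f‖ₑ ^ 2 ≤ (ENNReal.ofReal M * ‖f‖ₑ) ^ 2 := by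
    calc ‖T f‖ₑ ^ 2 = ∫⁻ x, ‖T f x‖ₑ ^ 2 ∂μ := Lp_two_enorm_sq _
      _ ≤ ∫⁻ x, ENNReal.ofReal M * ∫⁻ y, ‖K x y‖ₑ * ‖f y‖ₑ ^ 2 ∂μ ∂μ := by
        refine lintegral_mono_ae ?_
        filter_upwards [hT f, hrow] with x hx hrowx
        rw [hx]
        calc _ ≤ (∫⁻ y, ‖K x y‖ₑ * ‖f y‖ₑ ∂μ) ^ 2 := by
              gcongr
              simpa only [enorm_mul] using enorm_integral_le_lintegral_enorm
                (fun y => K x y * f y) (μ := μ)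
          _ ≤ _ := lintegral_mul_sq_le (hKx x) hf
          _ ≤ _ := by gcongr
      _ = ENNReal.ofReal M * ∫⁻ x, ∫⁻ y, ‖K x y‖ₑ * ‖f y‖ₑ ^ 2 ∂μ ∂μ :=
        lintegral_const_mul' _ _ ENNReal.ofReal_ne_top
      _ = ENNReal.ofReal M * ∫⁻ y, ∫⁻ x, ‖K x y‖ₑ * ‖f y‖ₑ ^ 2 ∂μ ∂μ := by
        rw [lintegral_lintegral_swap]
        exact (hK.enorm.mul ((hf.comp measurable_snd).pow_const 2)).aemeasurable
      _ ≤ ENNReal.ofReal M * ∫⁻ y, ENNReal.ofReal M * ‖f y‖ₑ ^ 2 ∂μ := by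
        refine mul_le_mul_right (lintegral_mono_ae ?_) _
        filter_upwards [hcol] with y hy
        rw [lintegral_mul_const' _ _ (by finiteness)]
        gcongr
      _ = _ := by
        rw [lintegral_const_mul' _ _ ENNReal.ofReal_ne_top, ← Lp_two_enorm_sq]; ring
  have h1 : ‖T f‖ₑ ≤ ENNReal.ofReal M * ‖f‖ₑ := (ENNReal.pow_le_pow_left_iff two_ne_zero).1 hint
  rw [← ofReal_norm, ← ofReal_norm, ← ENNReal.ofReal_mul hM] at h1
  exact (ENNReal.ofReal_le_ofReal_iff (by positivity)).1 h1

theorem lintegral_exp_mul_Iic {a : ℝ} (ha : 0 < a) {C : ℝ} (hC : 0 ≤ C) (c : ℝ) :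
    ∫⁻ y in Iic c, ENNReal.ofReal (C * Real.exp (a * y)) =
      ENNReal.ofReal (C * (Real.exp (a * c) / a)) := by
  rw [← ofReal_integral_eq_lintegral_ofReal ((integrableOn_exp_mul_Iic ha c).const_mul C)
    (.of_forall fun y => by positivity), integral_const_mul, integral_exp_mul_Iic ha]

theorem lintegral_exp_mul_Ioi {a : ℝ} (ha : a < 0) {C : ℝ} (hC : 0 ≤ C) (c : ℝ) :
    ∫⁻ y in Ioi c, ENNReal.ofReal (C * Real.exp (a * y)) =
      ENNReal.ofReal (C * (-Real.exp (a * c) / a)) := by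
  rw [← ofReal_integral_eq_lintegral_ofReal ((integrableOn_exp_mul_Ioi ha c).const_mul C)
    (.of_forall fun y => by positivity), integral_const_mul, integral_exp_mul_Ioi ha]

theorem lintegral_exp_neg_mul_abs_sub {a : ℝ} (ha : 0 < a) {C : ℝ} (hC : 0 ≤ C) (x : ℝ) :
    ∫⁻ y, ENNReal.ofReal (C * Real.exp (-a * |x - y|)) = ENNReal.ofReal (2 * C / a) := by
  rw [← lintegral_add_compl _ (measurableSet_Iic (a := x)), compl_Iic]
  have h1 : ∫⁻ y in Iic x, ENNReal.ofReal (C * Real.exp (-a * |x - y|)) =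
      ∫⁻ y in Iic x, ENNReal.ofReal (C * Real.exp (-a * x) * Real.exp (a * y)) := by
    refine setLIntegral_congr_fun measurableSet_Iic fun y hy => ?_
    simp only [mem_Iic] at hy
    rw [abs_of_nonneg (by linarith), mul_assoc, ← Real.exp_add]
    ring_nf
  have h2 : ∫⁻ y in Ioi x, ENNReal.ofReal (C * Real.exp (-a * |x - y|)) =
      ∫⁻ y in Ioi x, ENNReal.ofReal (C * Real.exp (a * x) * Real.exp (-a * y)) := by
    refine setLIntegral_congr_fun measurableSet_Ioi fun y hy => ?_
    simp only [mem_Ioi] at hy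
    rw [abs_of_neg (by linarith), mul_assoc, ← Real.exp_add]
    ring_nf
  have h3 : Real.exp (a * x) * Real.exp (-a * x) = 1 := by
    rw [← Real.exp_add]; simp
  rw [h1, h2, lintegral_exp_mul_Iic ha (by positivity),
    lintegral_exp_mul_Ioi (by linarith) (by positivity),
    ← ENNReal.ofReal_add (by positivity) (by rw [neg_div_neg_eq]; positivity)]
  congr 1
  rw [neg_div_neg_eq, ← mul_div_assoc, ← mul_div_assoc, ← add_div]
  congr 1
  linear_combination 2 * C * h3

/-- Row bound for a kernel with an exponential cross term on one half-line, and a convolution term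
plus a reflected term on the other. -/
theorem lintegral_le_of_exp_bounds {F : ℝ → ENNReal} {a b C₀ C₁ C₂ x : ℝ} (ha : 0 < a) (hb : 0 < b)
    (h₀ : 0 ≤ C₀) (h₁ : 0 ≤ C₁) (h₂ : 0 ≤ C₂)
    (hneg : ∀ y ≤ 0, F y ≤ ENNReal.ofReal (C₀ * Real.exp (b * y)))
    (hpos : ∀ y > 0, F y ≤ ENNReal.ofReal (C₁ * Real.exp (-a * |x - y|)) +
      ENNReal.ofReal (C₂ * Real.exp (-a * y))) :
    ∫⁻ y, F y ≤ ENNReal.ofReal (C₀ / b + (2 * C₁ / a + C₂ / a)) := by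
  rw [← lintegral_add_compl _ (measurableSet_Iic (a := (0 : ℝ))), compl_Iic,
    ENNReal.ofReal_add (by positivity) (by positivity),
    ENNReal.ofReal_add (by positivity) (by positivity)]
  refine add_le_add ?_ ?_
  · refine (setLIntegral_mono' measurableSet_Iic hneg).trans_eq ?_
    rw [lintegral_exp_mul_Iic hb h₀]
    simp [div_eq_mul_inv]
  · refine (setLIntegral_mono' measurableSet_Ioi hpos).trans ?_
    rw [lintegral_add_right _ (by fun_prop)]
    refine add_le_add ?_ ?_
    · exact (setLIntegral_le_lintegral _ _).trans_eq (lintegral_exp_neg_mul_abs_sub ha h₁ x)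
    · rw [lintegral_exp_mul_Ioi (by linarith) h₂]
      simp [div_eq_mul_inv]

theorem kp_sq (z : ℂ) : kp z ^ 2 = I - z := by
  simp [kp, ← Complex.cpow_mul_nat]

theorem km_sq (z : ℂ) : km z ^ 2 = -I - z := by
  simp [km, ← Complex.cpow_mul_nat]

theorem kp_re_nonneg (z : ℂ) : 0 ≤ (kp z).re := by
  rw [kp, one_div, Complex.cpow_inv_two_re]; positivity

theorem km_re_nonneg (z : ℂ) : 0 ≤ (km z).re := by
  rw [km, one_div, Complex.cpow_inv_two_re]; positivity

theorem kp_re_mul_im (z : ℂ) : 2 * ((kp z).re * (kp z).im) = 1 - z.im := by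
  have h := congrArg Complex.im (kp_sq z)
  simp [sq] at h
  linarith

theorem km_re_mul_im (z : ℂ) : 2 * ((km z).re * (km z).im) = -(1 + z.im) := by
  have h := congrArg Complex.im (km_sq z)
  simp [sq] at h
  linarith

theorem kp_im_sq (z : ℂ) : (kp z).im ^ 2 = z.re + (kp z).re ^ 2 := by
  have h := congrArg Complex.re (kp_sq z)
  simp [sq] at h
  linarith

theorem km_im_sq (z : ℂ) : (km z).im ^ 2 = z.re + (km z).re ^ 2 := by
  have h := congrArg Complex.re (km_sq z)
  simp [sq] at h
  linarith

theorem kp_norm_sq_le {z : ℂ} (hz : z ∈ Sset) : ‖kp z‖ ^ 2 ≤ z.re + 2 := by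
  rw [← norm_pow, kp_sq]
  obtain ⟨h0, h1⟩ := hz
  rw [abs_lt] at h1
  refine (Complex.norm_le_abs_re_add_abs_im _).trans ?_
  simp only [sub_re, I_re, zero_sub, abs_neg, sub_im, I_im, abs_of_nonneg h0]
  rw [abs_of_pos (by linarith)]
  linarith

theorem km_norm_sq_le {z : ℂ} (hz : z ∈ Sset) : ‖km z‖ ^ 2 ≤ z.re + 2 := by
  rw [← norm_pow, km_sq]
  obtain ⟨h0, h1⟩ := hz
  rw [abs_lt] at h1
  refine (Complex.norm_le_abs_re_add_abs_im _).trans ?_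
  simp only [sub_re, neg_re, I_re, neg_zero, zero_sub, abs_neg, sub_im, neg_im, I_im,
    abs_of_nonneg h0]
  rw [abs_of_neg (by linarith)]
  linarith

theorem kp_re_pos {z : ℂ} (hz : z ∈ Sset) : 0 < (kp z).re := by
  have h := kp_re_mul_im z
  have h1 := (abs_lt.1 hz.2).2
  refine (kp_re_nonneg z).lt_of_ne fun h0 => ?_
  rw [← h0] at h
  linarith

theorem km_re_pos {z : ℂ} (hz : z ∈ Sset) : 0 < (km z).re := by
  have h := km_re_mul_im z
  have h1 := (abs_lt.1 hz.2).1
  refine (km_re_nonneg z).lt_of_ne fun h0 => ?_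
  rw [← h0] at h
  linarith

theorem kp_im_pos {z : ℂ} (hz : z ∈ Sset) : 0 < (kp z).im := by
  have h := kp_re_mul_im z
  have h1 := (abs_lt.1 hz.2).2
  exact pos_of_mul_pos_right (by linarith : 0 < (kp z).re * (kp z).im) (kp_re_nonneg z)

theorem km_im_neg {z : ℂ} (hz : z ∈ Sset) : (km z).im < 0 := by
  have h := km_re_mul_im z
  have h1 := (abs_lt.1 hz.2).1
  by_contra! h2
  have := mul_nonneg (km_re_nonneg z) h2
  linarith

theorem sqrt_le_kp_im {z : ℂ} (hz : z ∈ Sset) : √z.re ≤ (kp z).im := by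
  rw [Real.sqrt_le_left (kp_im_pos hz).le, kp_im_sq]
  nlinarith [sq_nonneg (kp z).re]

theorem sqrt_le_neg_km_im {z : ℂ} (hz : z ∈ Sset) : √z.re ≤ -(km z).im := by
  rw [Real.sqrt_le_left (by linarith [km_im_neg hz]), neg_sq, km_im_sq]
  nlinarith [sq_nonneg (km z).re]

theorem kp_add_km_mul_kp_sub_km (z : ℂ) : (kp z + km z) * (kp z - km z) = 2 * I := by
  linear_combination kp_sq z - km_sq z

theorem norm_kp_add_km_mul_norm_kp_sub_km (z : ℂ) : ‖kp z + km z‖ * ‖kp z - km z‖ = 2 := by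
  rw [← norm_mul, kp_add_km_mul_kp_sub_km]; simp

theorem kp_add_km_ne_zero (z : ℂ) : kp z + km z ≠ 0 := by
  intro h
  have := norm_kp_add_km_mul_norm_kp_sub_km z
  simp [h] at this

theorem measurable_Rker (z : ℂ) : Measurable (Function.uncurry (Rker z)) := by
  have hx : Measurable fun p : ℝ × ℝ => p.1 := measurable_fst
  have hy : Measurable fun p : ℝ × ℝ => p.2 := measurable_snd
  have e : Function.uncurry (Rker z) = fun p : ℝ × ℝ => Rker z p.1 p.2 := rfl
  rw [e]
  unfold Rker
  refine Measurable.ite ((measurableSet_le measurable_const hx).inter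
    (measurableSet_le hy measurable_const)) (by fun_prop) ?_
  refine Measurable.ite ((measurableSet_le hx measurable_const).inter
    (measurableSet_le measurable_const hy)) (by fun_prop) ?_
  exact Measurable.ite (measurableSet_le measurable_const hx) (by fun_prop) (by fun_prop)

theorem Rker_symm (z : ℂ) (x y : ℝ) : Rker z x y = Rker z y x := by
  unfold Rker
  rw [abs_sub_comm y x, add_comm (y : ℂ) x]
  split_ifs <;> first
    | rfl
    | (exfalso; grind)
    | (obtain rfl : x = 0 := by grind
       obtain rfl : y = 0 := by grind
       rfl)
    | (congr 2; ring)

theorem norm_Rker_of_nonneg_of_nonpos {z : ℂ} {x y : ℝ} (hx : 0 ≤ x) (hy : y ≤ 0) :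
    ‖Rker z x y‖ =
      Real.exp (-(kp z).re * x + (km z).re * y) / ‖kp z + km z‖ := by
  rw [Rker, if_pos ⟨hx, hy⟩, norm_div, Complex.norm_exp]
  simp

theorem norm_Rker_le_of_pos_of_pos {z : ℂ} {x y : ℝ} (hx : 0 < x) (hy : 0 < y) :
    ‖Rker z x y‖ ≤ 1 / (2 * ‖kp z‖) * Real.exp (-(kp z).re * |x - y|) +
      ‖kp z - km z‖ / (2 * ‖kp z‖ * ‖kp z + km z‖) * Real.exp (-(kp z).re * (x + y)) := by
  rw [Rker, if_neg (by grind), if_neg (by grind), if_pos hx.le]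
  refine (norm_add_le _ _).trans_eq ?_
  simp only [norm_div, norm_mul, Complex.norm_exp]
  simp
  ring

theorem norm_Rker_le_of_neg_of_neg {z : ℂ} {x y : ℝ} (hx : x < 0) (hy : y < 0) :
    ‖Rker z x y‖ ≤ 1 / (2 * ‖km z‖) * Real.exp (-(km z).re * |x - y|) +
      ‖kp z - km z‖ / (2 * ‖km z‖ * ‖kp z + km z‖) * Real.exp ((km z).re * (x + y)) := by
  rw [Rker, if_neg (by grind), if_neg (by grind), if_neg (by grind)]
  refine (norm_sub_le _ _).trans_eq ?_
  simp only [norm_div, norm_mul, Complex.norm_exp]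
  simp
  ring

/-- Elementary bound for the row integrals of the kernel, where `a, b` are the decay rates,
`n` the modulus of the root with decay rate `a`, and `S`, `D` the moduli of the sum and difference
of the two roots. -/
theorem row_bound {r s a b n m S D p q : ℝ} (hs : |s| < 1) (ha : 0 < a) (hb : 0 < b)
    (hp : 2 * (a * p) = 1 - s) (hq : 2 * (b * q) = 1 + s) (hpn : p ≤ n) (hqm : q ≤ m)
    (hn : 0 < n) (hm : 0 < m) (hnr : n ^ 2 ≤ r + 2) (hmr : m ^ 2 ≤ r + 2)
    (hSD : S * D = 2) (hD : D ≤ n + m) (hD0 : 0 ≤ D) :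
    1 / S / b + (2 * (1 / (2 * n)) / a + D / (2 * n * S) / a) ≤ (4 * r + 10) / (1 - |s|) := by
  obtain ⟨hs1, hs2⟩ := abs_lt.1 hs
  have hD' : 0 < D := hD0.lt_of_ne (by rintro rfl; simp at hSD)
  obtain rfl : S = 2 / D := by field_simp; linarith
  have hia : 1 / a ≤ 2 * n / (1 - s) := by
    rw [div_le_div_iff₀ ha (by linarith)]; nlinarith
  have hib : 1 / b ≤ 2 * m / (1 + s) := by
    rw [div_le_div_iff₀ hb (by linarith)]; nlinarith
  have hDm : D * m ≤ 2 * (r + 2) := by nlinarith [sq_nonneg (n - m)]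
  have hDD : D ^ 2 ≤ 4 * (r + 2) := by nlinarith [sq_nonneg (n - m)]
  have e1 : 1 / (2 / D) / b ≤ 2 * (r + 2) / (1 + s) := by
    calc 1 / (2 / D) / b = D / 2 * (1 / b) := by field_simp
      _ ≤ D / 2 * (2 * m / (1 + s)) := by gcongr
      _ = D * m / (1 + s) := by ring
      _ ≤ _ := by gcongr; linarith
  have e2 : 2 * (1 / (2 * n)) / a ≤ 2 / (1 - s) := by
    calc 2 * (1 / (2 * n)) / a = 1 / n * (1 / a) := by field_simp
      _ ≤ 1 / n * (2 * n / (1 - s)) := by gcongr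
      _ = _ := by field_simp
  have e3 : D / (2 * n * (2 / D)) / a ≤ 2 * (r + 2) / (1 - s) := by
    calc D / (2 * n * (2 / D)) / a = D ^ 2 / (4 * n) * (1 / a) := by field_simp; norm_num
      _ ≤ D ^ 2 / (4 * n) * (2 * n / (1 - s)) := by gcongr
      _ = D ^ 2 / 2 / (1 - s) := by field_simp; norm_num
      _ ≤ _ := by gcongr; linarith
  have hr : 0 ≤ r + 2 := (sq_nonneg n).trans hnr
  have e4 : 2 / (1 - s) ≤ 2 / (1 - |s|) := by
    gcongr
    exact le_abs_self s
  have e5 : 2 * (r + 2) / (1 + s) + 2 * (r + 2) / (1 - s) ≤ (4 * (r + 2)) / (1 - |s|) := by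
    rw [div_add_div _ _ (by linarith) (by linarith), div_le_div_iff₀ (by nlinarith) (by linarith)]
    have : 1 - |s| ≤ (1 + s) * (1 - s) := by
      nlinarith [sq_abs s, abs_nonneg s]
    nlinarith
  have e6 : (4 * r + 10) / (1 - |s|) = (4 * (r + 2)) / (1 - |s|) + 2 / (1 - |s|) := by ring
  linarith

theorem lintegral_Rker_le {z : ℂ} (hz : z ∈ Sset) {x : ℝ} (hx : x ≠ 0) :
    ∫⁻ y, ‖Rker z x y‖ₑ ≤ ENNReal.ofReal ((4 * z.re + 10) / (1 - |z.im|)) := by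
  have hA := kp_re_pos hz
  have hB := km_re_pos hz
  have hkp : 0 < ‖kp z‖ := norm_pos_iff.2 fun h => by simp [h] at hA
  have hkm : 0 < ‖km z‖ := norm_pos_iff.2 fun h => by simp [h] at hB
  have hpn : (kp z).im ≤ ‖kp z‖ := (le_abs_self _).trans (abs_im_le_norm _)
  have hqm : -(km z).im ≤ ‖km z‖ := (neg_le_abs _).trans (abs_im_le_norm _)
  have hS := norm_nonneg (kp z + km z)
  have hD := norm_nonneg (kp z - km z)
  have hq : 2 * ((km z).re * -(km z).im) = 1 + z.im := by linarith [km_re_mul_im z]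
  rcases hx.lt_or_gt with hx | hx
  · have hrow := row_bound (s := -z.im) (by rw [abs_neg]; exact hz.2) hB hA (by linarith)
      (by linarith [kp_re_mul_im z]) hqm hpn hkm hkp (km_norm_sq_le hz) (kp_norm_sq_le hz)
      (norm_kp_add_km_mul_norm_kp_sub_km z)
      ((norm_sub_le _ _).trans_eq (add_comm _ _)) hD
    rw [abs_neg] at hrow
    refine le_trans ?_ (ENNReal.ofReal_le_ofReal hrow)
    rw [← lintegral_neg_eq_self]
    refine lintegral_le_of_exp_bounds (x := -x) hB hA (by positivity) (by positivity)
      (by positivity) (fun y hy => ?_) (fun y hy => ?_)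
    · rw [← ofReal_norm, Rker_symm, norm_Rker_of_nonneg_of_nonpos (by linarith) hx.le]
      refine ENNReal.ofReal_le_ofReal ?_
      rw [div_eq_mul_one_div, mul_comm]
      gcongr
      nlinarith
    · rw [← ofReal_norm, ← ENNReal.ofReal_add (by positivity) (by positivity)]
      refine ENNReal.ofReal_le_ofReal ((norm_Rker_le_of_neg_of_neg hx (by linarith)).trans ?_)
      rw [show |x - -y| = |-x - y| by rw [← abs_neg]; ring_nf]
      exact add_le_add_right (mul_le_mul_of_nonneg_left (Real.exp_le_exp.2 (by nlinarith))
        (by positivity)) _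
  · have hrow := row_bound hz.2 hA hB (kp_re_mul_im z) hq hpn hqm hkp hkm (kp_norm_sq_le hz)
      (km_norm_sq_le hz) (norm_kp_add_km_mul_norm_kp_sub_km z) (norm_sub_le _ _) hD
    refine le_trans ?_ (ENNReal.ofReal_le_ofReal hrow)
    refine lintegral_le_of_exp_bounds (x := x) hA hB (by positivity) (by positivity)
      (by positivity) (fun y hy => ?_) (fun y hy => ?_)
    · rw [← ofReal_norm, norm_Rker_of_nonneg_of_nonpos hx.le hy]
      refine ENNReal.ofReal_le_ofReal ?_
      rw [div_eq_mul_one_div, mul_comm]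
      gcongr
      nlinarith
    · rw [← ofReal_norm, ← ENNReal.ofReal_add (by positivity) (by positivity)]
      refine ENNReal.ofReal_le_ofReal ((norm_Rker_le_of_pos_of_pos hx hy).trans ?_)
      exact add_le_add_right (mul_le_mul_of_nonneg_left (Real.exp_le_exp.2 (by nlinarith))
        (by positivity)) _

theorem enorm_sq_eq_ofReal (w : ℂ) : ‖w‖ₑ ^ 2 = ENNReal.ofReal (‖w‖ ^ 2) := by
  rw [← ofReal_norm, ENNReal.ofReal_pow (norm_nonneg _)]

/-- Testing the resolvent on the function `y ↦ exp (conj (km z) * y)` supported on the negative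
half-line. -/
theorem le_norm_sq_of_kernel {z : ℂ} (hz : z ∈ Sset)
    (T : Lp ℂ 2 (volume : Measure ℝ) →L[ℂ] Lp ℂ 2 (volume : Measure ℝ))
    (hT : ∀ f : Lp ℂ 2 (volume : Measure ℝ),
      ∀ᵐ x : ℝ, (T f : ℝ → ℂ) x = ∫ y : ℝ, Rker z x y * (f : ℝ → ℂ) y) :
    1 / (4 * ‖kp z + km z‖ ^ 2 * (kp z).re * (km z).re) ≤ ‖T‖ ^ 2 := by
  have hA := kp_re_pos hz
  have hB := km_re_pos hz
  have hS : 0 < ‖kp z + km z‖ := norm_pos_iff.2 (kp_add_km_ne_zero z)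
  set A := (kp z).re
  set B := (km z).re
  set S := ‖kp z + km z‖
  set g : ℝ → ℂ := (Iic 0).indicator fun y => Complex.exp (starRingEnd ℂ (km z) * y) with hg
  have hgn (y : ℝ) : ‖g y‖ ^ 2 = (Iic (0 : ℝ)).indicator (fun y => Real.exp (2 * B * y)) y := by
    by_cases hy : y ∈ Iic (0 : ℝ)
    · rw [hg, indicator_of_mem hy, indicator_of_mem hy, Complex.norm_exp, ← Real.exp_nat_mul]
      simp [B, mul_assoc]
    · rw [hg, indicator_of_notMem hy, indicator_of_notMem hy]
      simp
  have hgm : Measurable g := Measurable.indicator (by fun_prop) measurableSet_Iic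
  have hgL : MemLp g 2 := by
    rw [memLp_two_iff_integrable_sq_norm hgm.aestronglyMeasurable]
    simp_rw [hgn]
    exact (integrableOn_exp_mul_Iic (by positivity) 0).integrable_indicator measurableSet_Iic
  set f := hgL.toLp g with hf
  have hfg : f =ᵐ[volume] g := hgL.coeFn_toLp
  have hfn : ‖f‖ ^ 2 = 1 / (2 * B) := by
    have h : ‖f‖ₑ ^ 2 = ENNReal.ofReal (1 / (2 * B)) := by
      rw [Lp_two_enorm_sq]
      calc _ = ∫⁻ x, ENNReal.ofReal (‖g x‖ ^ 2) := by
            refine lintegral_congr_ae ?_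
            filter_upwards [hfg] with x hx
            rw [hx, enorm_sq_eq_ofReal]
        _ = ∫⁻ x in Iic 0, ENNReal.ofReal (1 * Real.exp (2 * B * x)) := by
            rw [← lintegral_indicator measurableSet_Iic]
            refine lintegral_congr fun x => ?_
            rw [hgn]
            by_cases hx : x ∈ Iic (0 : ℝ) <;> simp [hx]
        _ = _ := by
            rw [lintegral_exp_mul_Iic (by positivity) zero_le_one]
            simp
    rwa [← ofReal_norm, ← ENNReal.ofReal_pow (norm_nonneg _),
      ENNReal.ofReal_eq_ofReal_iff (by positivity) (by positivity)] at h
  have hTf : ∀ᵐ x : ℝ, 0 < x → ‖T f x‖ ^ 2 = 1 / (S * (2 * B)) ^ 2 * Real.exp (-2 * A * x) := by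
    filter_upwards [hT f] with x hx hx0
    have : T f x = Complex.exp (-(kp z) * x) / (kp z + km z) * ((1 / (2 * B) : ℝ) : ℂ) := by
      rw [hx]
      calc _ = ∫ y, Rker z x y * g y := by
            refine integral_congr_ae ?_
            filter_upwards [hfg] with y hy
            rw [hy]
        _ = ∫ y in Iic 0, Complex.exp (-(kp z) * x) / (kp z + km z) *
              ((Real.exp (2 * B * y) : ℝ) : ℂ) := by
            rw [← integral_indicator measurableSet_Iic]
            refine integral_congr_ae (.of_forall fun y => ?_)
            by_cases hy : y ∈ Iic (0 : ℝ)
            · simp only [hg, indicator_of_mem hy]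
              rw [Rker, if_pos ⟨hx0.le, hy⟩, div_mul_eq_mul_div, div_mul_eq_mul_div,
                ← Complex.exp_add, Complex.ofReal_exp, ← Complex.exp_add]
              congr 2
              have hadd : km z + starRingEnd ℂ (km z) = 2 * (B : ℂ) := by
                rw [Complex.add_conj]; simp [B]
              push_cast
              linear_combination (y : ℂ) * hadd
            · simp only [hg, indicator_of_notMem hy, mul_zero]
        _ = _ := by
            rw [integral_const_mul, integral_complex_ofReal, integral_exp_mul_Iic (by positivity)]
            simp
    rw [this, norm_mul, norm_div, Complex.norm_exp, Complex.norm_real, Real.norm_eq_abs,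
      abs_of_pos (by positivity), mul_pow, div_pow, ← Real.exp_nat_mul]
    have e : ((2 : ℕ) : ℝ) * (-(kp z) * (x : ℂ)).re = -2 * A * x := by simp [A]; ring
    rw [e]
    change _ / S ^ 2 * _ = _
    field_simp
  have hTn : 1 / (S * (2 * B)) ^ 2 * (1 / (2 * A)) ≤ ‖T f‖ ^ 2 := by
    have h : ENNReal.ofReal (1 / (S * (2 * B)) ^ 2 * (1 / (2 * A))) ≤ ‖T f‖ₑ ^ 2 := by
      rw [Lp_two_enorm_sq]
      refine le_trans (le_of_eq ?_) (setLIntegral_le_lintegral (Ioi 0) _)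
      calc _ = ∫⁻ x in Ioi 0, ENNReal.ofReal (1 / (S * (2 * B)) ^ 2 * Real.exp (-2 * A * x)) := by
            rw [lintegral_exp_mul_Ioi (by linarith) (by positivity)]
            simp [neg_div_neg_eq]
        _ = _ := by
            refine setLIntegral_congr_fun_ae measurableSet_Ioi ?_
            filter_upwards [hTf] with x hx hx0
            rw [enorm_sq_eq_ofReal, hx hx0]
    rwa [← ofReal_norm, ← ENNReal.ofReal_pow (norm_nonneg _),
      ENNReal.ofReal_le_ofReal_iff (by positivity)] at h
  have hop : ‖T f‖ ^ 2 ≤ ‖T‖ ^ 2 * ‖f‖ ^ 2 := by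
    rw [← mul_pow]
    gcongr
    exact T.le_opNorm f
  rw [hfn] at hop
  have h := hTn.trans hop
  have e : 1 / (4 * S ^ 2 * A * B) = 1 / (S * (2 * B)) ^ 2 * (1 / (2 * A)) * (2 * B) := by
    field_simp
    norm_num
  rw [e]
  calc _ ≤ ‖T‖ ^ 2 * (1 / (2 * B)) * (2 * B) := by gcongr
    _ = _ := by field_simp

theorem re_div_sqrt_le {z : ℂ} (hz : z ∈ Sset) (hr : 0 < z.re) :
    (z.re / √(1 - z.im ^ 2)) ^ 2 ≤ 1 / (4 * ‖kp z + km z‖ ^ 2 * (kp z).re * (km z).re) := by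
  obtain ⟨hs1, hs2⟩ := abs_lt.1 hz.2
  have hA := kp_re_pos hz
  have hB := km_re_pos hz
  have hS : 0 < ‖kp z + km z‖ := norm_pos_iff.2 (kp_add_km_ne_zero z)
  have hsq : 0 < 1 - z.im ^ 2 := by nlinarith
  have hrt := Real.sqrt_pos.2 hr
  have hrr := Real.sq_sqrt hr.le
  have h1 := sqrt_le_kp_im hz
  have h2 := sqrt_le_neg_km_im hz
  have hD : 2 * √z.re ≤ ‖kp z - km z‖ := by
    refine le_trans ?_ ((le_abs_self _).trans (abs_im_le_norm _))
    rw [sub_im]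
    linarith
  have hSr : ‖kp z + km z‖ * √z.re ≤ 1 := by
    nlinarith [norm_kp_add_km_mul_norm_kp_sub_km z]
  have hAr : 2 * ((kp z).re * √z.re) ≤ 1 - z.im := by
    nlinarith [kp_re_mul_im z]
  have hBr : 2 * ((km z).re * √z.re) ≤ 1 + z.im := by
    nlinarith [km_re_mul_im z]
  rw [div_pow, Real.sq_sqrt hsq.le, div_le_div_iff₀ hsq (by positivity), one_mul]
  calc _ = (‖kp z + km z‖ * √z.re) ^ 2 * (2 * ((kp z).re * √z.re) * (2 * ((km z).re * √z.re))) := by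
        linear_combination (-4 * ‖kp z + km z‖ ^ 2 * (kp z).re * (km z).re * (z.re + √z.re ^ 2)) * hrr
    _ ≤ 1 ^ 2 * ((1 - z.im) * (1 + z.im)) := by
        gcongr
    _ = _ := by ring

theorem stmt0 :
    ∀ ε : ℝ, 0 < ε → ∃ r₀ : ℝ, 0 < r₀ ∧ ∀ z : ℂ, z ∈ Sset → r₀ ≤ z.re →
    ∀ T : Lp ℂ 2 (volume : Measure ℝ) →L[ℂ] Lp ℂ 2 (volume : Measure ℝ),
      (∀ f : Lp ℂ 2 (volume : Measure ℝ),
        ∀ᵐ x : ℝ ∂(volume : Measure ℝ), (T f : ℝ → ℂ) x = ∫ y : ℝ, Rker z x y * (f : ℝ → ℂ) y) →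
      (1 - ε) * z.re / Real.sqrt (1 - z.im ^ 2) ≤ ‖T‖ ∧
        ‖T‖ ≤ 4 * (1 + ε) * z.re / (1 - |z.im|) := by

  intro ε hε
  refine ⟨3 / ε, by positivity, fun z hz hr T hT => ?_⟩
  have hr0 : 0 < z.re := lt_of_lt_of_le (by positivity) hr
  have hs : 0 < 1 - |z.im| := by linarith [hz.2]
  constructor
  · have h := abs_le_of_sq_le_sq ((re_div_sqrt_le hz hr0).trans (le_norm_sq_of_kernel hz T hT))
      (norm_nonneg T)
    refine le_trans ?_ ((le_abs_self _).trans h)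
    gcongr
    nlinarith
  · have hne : ∀ᵐ x : ℝ, x ≠ 0 := Measure.ae_ne volume 0
    have h := norm_le_of_schur (measurable_Rker z) (by positivity)
      (hne.mono fun x hx => lintegral_Rker_le hz hx)
      (hne.mono fun y hy => by
        simp_rw [Rker_symm z _ y]
        exact lintegral_Rker_le hz hy) T hT
    refine h.trans ?_
    rw [div_le_iff₀ hε] at hr
    gcongr
    linarith
end

section
/- For every r ∈ [0,+∞), every s ∈ {−1,1} and every η > 0, there exists a smooth compactly supported function ψ : ℝ → ℂ with ∫_ℝ |ψ(x)|² dx = 1 such that ∫_ℝ |−ψ″(x) + i·sgn(x)·ψ(x) − (r + i·s)·ψ(x)|² dx ≤ η². (This provides a singular Weyl sequence showing that every point of [0,+∞) + i·{−1,1} belongs to the spectrum of H = −d²/dx² + i·sgn(x).) -/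
open MeasureTheory Complex Set

/-- The wave packet `a e^{ikx} φ(εx - c)`. -/
noncomputable def wavePacket (φ : ℝ → ℝ) (a k ε c : ℝ) (x : ℝ) : ℂ :=
  a * (Complex.exp (Complex.I * k * x) * (φ (ε * x - c) : ℂ))

theorem contDiff_wavePacket {φ : ℝ → ℝ} (hφ : ContDiff ℝ (⊤ : ℕ∞) φ) (a k ε c : ℝ) :
    ContDiff ℝ (⊤ : ℕ∞) (wavePacket φ a k ε c) := by
  have h1 : ContDiff ℝ (⊤ : ℕ∞) fun x : ℝ => ((φ (ε * x - c) : ℝ) : ℂ) :=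
    Complex.ofRealCLM.contDiff.comp (hφ.comp (by fun_prop))
  have h2 : ContDiff ℝ (⊤ : ℕ∞) fun x : ℝ => Complex.exp (Complex.I * k * x) :=
    (contDiff_const.mul Complex.ofRealCLM.contDiff).cexp
  exact contDiff_const.mul (h2.mul h1)

theorem hasCompactSupport_wavePacket {φ : ℝ → ℝ} (hφ : HasCompactSupport φ) (a k c : ℝ)
    {ε : ℝ} (hε : ε ≠ 0) : HasCompactSupport (wavePacket φ a k ε c) := by
  have h : HasCompactSupport fun x => φ (ε * x - c) :=
    hφ.comp_homeomorph ((Homeomorph.mulLeft₀ ε hε).trans (Homeomorph.subRight c))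
  refine h.mono fun x hx h0 => hx ?_
  simp only at h0
  simp [wavePacket, h0]

theorem norm_wavePacket_sq (φ : ℝ → ℝ) (a k ε c x : ℝ) :
    ‖wavePacket φ a k ε c x‖ ^ 2 = a ^ 2 * φ (ε * x - c) ^ 2 := by
  have h : ‖Complex.exp (Complex.I * k * x)‖ = 1 := by simp [Complex.norm_exp]
  rw [wavePacket, norm_mul, norm_mul, h, one_mul, Complex.norm_real, Complex.norm_real,
    mul_pow, Real.norm_eq_abs, Real.norm_eq_abs, sq_abs, sq_abs]

theorem hasDerivAt_exp_mul_comp {φ : ℝ → ℝ} (hφ : Differentiable ℝ φ) (k ε c x : ℝ) :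
    HasDerivAt (fun y : ℝ => Complex.exp (Complex.I * k * y) * (φ (ε * y - c) : ℂ))
      (Complex.I * k * (Complex.exp (Complex.I * k * x) * (φ (ε * x - c) : ℂ))
        + ε * (Complex.exp (Complex.I * k * x) * ((deriv φ (ε * x - c) : ℝ) : ℂ))) x := by
  have h1 : HasDerivAt (fun y : ℝ => φ (ε * y - c)) (deriv φ (ε * x - c) * (ε * 1)) x :=
    (hφ (ε * x - c)).hasDerivAt.comp x (((hasDerivAt_id x).const_mul ε).sub_const c)
  have h2 : HasDerivAt (fun y : ℝ => Complex.exp (Complex.I * k * y))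
      (Complex.exp (Complex.I * k * x) * (Complex.I * k * 1)) x :=
    ((hasDerivAt_id x).ofReal_comp.const_mul (Complex.I * k)).cexp
  refine (h2.mul h1.ofReal_comp).congr_deriv ?_
  push_cast
  ring

theorem deriv_deriv_wavePacket {φ : ℝ → ℝ} (hφ : Differentiable ℝ φ)
    (hφ' : Differentiable ℝ (deriv φ)) (a k ε c x : ℝ) :
    deriv (deriv (wavePacket φ a k ε c)) x =
      a * Complex.exp (Complex.I * k * x) * (ε ^ 2 * ((deriv (deriv φ) (ε * x - c) : ℝ) : ℂ)
        + 2 * Complex.I * k * ε * deriv φ (ε * x - c) - k ^ 2 * φ (ε * x - c)) := by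
  have h1 : deriv (wavePacket φ a k ε c) = fun x : ℝ =>
      (a : ℂ) * (Complex.I * k * (Complex.exp (Complex.I * k * x) * (φ (ε * x - c) : ℂ))
        + ε * (Complex.exp (Complex.I * k * x) * ((deriv φ (ε * x - c) : ℝ) : ℂ))) :=
    funext fun y => ((hasDerivAt_exp_mul_comp hφ k ε c y).const_mul (a : ℂ)).deriv
  rw [h1, ((((hasDerivAt_exp_mul_comp hφ k ε c x).const_mul (Complex.I * k)).fun_add
    ((hasDerivAt_exp_mul_comp hφ' k ε c x).const_mul (ε : ℂ))).const_mul (a : ℂ)).deriv]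
  linear_combination (a * k ^ 2 * Complex.exp (Complex.I * k * x) * φ (ε * x - c) : ℂ)
    * Complex.I_sq

theorem norm_residual_wavePacket_sq {φ : ℝ → ℝ} (hφ : Differentiable ℝ φ)
    (hφ' : Differentiable ℝ (deriv φ)) (a k ε c x s : ℝ)
    (hs : φ (ε * x - c) ≠ 0 → Real.sign x = s) :
    ‖-(deriv (deriv (wavePacket φ a k ε c)) x)
        + Complex.I * (Real.sign x : ℂ) * wavePacket φ a k ε c x
        - (((k ^ 2 : ℝ) : ℂ) + Complex.I * (s : ℂ)) * wavePacket φ a k ε c x‖ ^ 2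
      = a ^ 2 * (ε ^ 4 * deriv (deriv φ) (ε * x - c) ^ 2
          + 4 * k ^ 2 * ε ^ 2 * deriv φ (ε * x - c) ^ 2) := by
  have hsign : (Real.sign x : ℂ) * wavePacket φ a k ε c x = s * wavePacket φ a k ε c x := by
    by_cases h : φ (ε * x - c) = 0
    · simp [wavePacket, h]
    · rw [hs h]
  have hexp : ‖Complex.exp (Complex.I * k * x)‖ = 1 := by simp [Complex.norm_exp]
  have key : -(deriv (deriv (wavePacket φ a k ε c)) x)
        + Complex.I * (Real.sign x : ℂ) * wavePacket φ a k ε c x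
        - (((k ^ 2 : ℝ) : ℂ) + Complex.I * (s : ℂ)) * wavePacket φ a k ε c x
      = -(a * Complex.exp (Complex.I * k * x) *
          (((ε ^ 2 * deriv (deriv φ) (ε * x - c) : ℝ) : ℂ)
            + ((2 * k * ε * deriv φ (ε * x - c) : ℝ) : ℂ) * Complex.I)) := by
    rw [mul_assoc Complex.I, hsign, deriv_deriv_wavePacket hφ hφ', wavePacket]
    push_cast
    ring
  rw [key, norm_neg, norm_mul, norm_mul, hexp, Complex.norm_real, mul_one, mul_pow,
    Real.norm_eq_abs, sq_abs, Complex.sq_norm, Complex.normSq_add_mul_I]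
  ring

theorem integral_comp_mul_sub {ε : ℝ} (hε : 0 < ε) (c : ℝ) (F : ℝ → ℝ) :
    ∫ x : ℝ, F (ε * x - c) = ε⁻¹ * ∫ x : ℝ, F x := by
  rw [Measure.integral_comp_mul_left (fun x => F (x - c)) ε, integral_sub_right_eq_self F c,
    abs_of_pos (inv_pos.2 hε), smul_eq_mul]

theorem sign_eq_of_abs_mul_sub_lt {s ε x : ℝ} (hs : s = -1 ∨ s = 1) (hε : 0 < ε)
    (hx : |ε * x - 2 * s| < 1) : Real.sign x = s := by
  rw [abs_lt] at hx
  rcases hs with rfl | rfl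
  · exact Real.sign_of_neg (by by_contra! h; nlinarith [mul_nonneg hε.le h])
  · exact Real.sign_of_pos (by by_contra! h; nlinarith [mul_nonneg hε.le (neg_nonneg.2 h)])

theorem exists_pos_pow_mul_add_le (B C : ℝ) {η : ℝ} (hη : 0 < η) :
    ∃ ε : ℝ, 0 < ε ∧ ε ^ 4 * B + ε ^ 2 * C ≤ η ^ 2 := by
  have hlim : Filter.Tendsto (fun ε : ℝ => ε ^ 4 * B + ε ^ 2 * C)
      (nhdsWithin 0 (Ioi 0)) (nhds 0) := by
    have h : Continuous fun ε : ℝ => ε ^ 4 * B + ε ^ 2 * C := by fun_prop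
    simpa using (h.tendsto 0).mono_left nhdsWithin_le_nhds
  obtain ⟨ε, h1, h2⟩ := ((hlim.eventually_le_const (pow_pos hη 2)).and
    self_mem_nhdsWithin).exists
  exact ⟨ε, h2, h1⟩

theorem hasCompactSupport_sq {f : ℝ → ℝ} (hf : HasCompactSupport f) :
    HasCompactSupport fun x => f x ^ 2 :=
  hf.mono fun x hx h0 => hx (by simp [h0])

theorem integrable_sq_of_hasCompactSupport {f : ℝ → ℝ} (hf : Continuous f)
    (hc : HasCompactSupport f) : Integrable fun x => f x ^ 2 := by
  have hf2 : Continuous fun x => f x ^ 2 := hf.pow 2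
  exact hf2.integrable_of_hasCompactSupport (hasCompactSupport_sq hc)

theorem exists_wavePacket_residual_le {φ : ℝ → ℝ} (hφ : ContDiff ℝ (⊤ : ℕ∞) φ)
    (hsupp : HasCompactSupport φ) (h0 : φ 0 ≠ 0) (hlt : ∀ u, φ u ≠ 0 → |u| < 1)
    {r : ℝ} (hr : 0 ≤ r) {s : ℝ} (hs : s = -1 ∨ s = 1) {η : ℝ} (hη : 0 < η) :
    ∃ ψ : ℝ → ℂ, ContDiff ℝ (⊤ : ℕ∞) ψ ∧ HasCompactSupport ψ ∧
      (∫ x : ℝ, ‖ψ x‖ ^ 2) = 1 ∧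
      (∫ x : ℝ, ‖-(deriv (deriv ψ) x) + Complex.I * (Real.sign x : ℂ) * ψ x
          - ((r : ℂ) + Complex.I * (s : ℂ)) * ψ x‖ ^ 2) ≤ η ^ 2 := by
  have hφ' : ContDiff ℝ (⊤ : ℕ∞) (deriv φ) := (contDiff_infty_iff_deriv.1 hφ).2
  have hφ'' : ContDiff ℝ (⊤ : ℕ∞) (deriv (deriv φ)) := (contDiff_infty_iff_deriv.1 hφ').2
  have hA : 0 < ∫ x, φ x ^ 2 := by
    have hc : Continuous fun x => φ x ^ 2 := hφ.continuous.pow 2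
    exact hc.integral_pos_of_hasCompactSupport_nonneg_nonzero (hasCompactSupport_sq hsupp)
      (fun x => sq_nonneg _) (pow_ne_zero 2 h0)
  set A := ∫ x, φ x ^ 2
  set B₁ := ∫ x, deriv φ x ^ 2
  set B₂ := ∫ x, deriv (deriv φ) x ^ 2
  obtain ⟨ε, hε, hle⟩ := exists_pos_pow_mul_add_le (B₂ / A) (4 * r * B₁ / A) hη
  have ha : √(ε / A) ^ 2 = ε / A := Real.sq_sqrt (by positivity)
  have hk : √r ^ 2 = r := Real.sq_sqrt hr
  refine ⟨wavePacket φ √(ε / A) √r ε (2 * s), contDiff_wavePacket hφ _ _ _ _,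
    hasCompactSupport_wavePacket hsupp _ _ _ hε.ne', ?_, ?_⟩
  · simp_rw [norm_wavePacket_sq]
    rw [integral_const_mul, integral_comp_mul_sub hε (2 * s) (fun u => φ u ^ 2), ha]
    change ε / A * (ε⁻¹ * A) = 1
    field_simp
  · have hres := fun x => norm_residual_wavePacket_sq (hφ.differentiable (by simp))
      (hφ'.differentiable (by simp)) √(ε / A) √r ε (2 * s) x s fun h =>
        sign_eq_of_abs_mul_sub_lt hs hε (hlt _ h)
    simp_rw [hk, ha] at hres
    simp_rw [hres]
    rw [integral_const_mul, integral_comp_mul_sub hε (2 * s)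
      (fun u => ε ^ 4 * deriv (deriv φ) u ^ 2 + 4 * r * ε ^ 2 * deriv φ u ^ 2),
      integral_add ((integrable_sq_of_hasCompactSupport hφ''.continuous hsupp.deriv.deriv).const_mul _)
        ((integrable_sq_of_hasCompactSupport hφ'.continuous hsupp.deriv).const_mul _),
      integral_const_mul, integral_const_mul]
    refine le_of_eq_of_le ?_ hle
    change ε / A * (ε⁻¹ * (ε ^ 4 * B₂ + 4 * r * ε ^ 2 * B₁)) = _
    field_simp

theorem stmt2 (r : ℝ) (hr : 0 ≤ r) (s : ℝ) (hs : s = -1 ∨ s = 1) (η : ℝ) (hη : 0 < η) :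
    ∃ ψ : ℝ → ℂ, ContDiff ℝ (⊤ : ℕ∞) ψ ∧ HasCompactSupport ψ ∧
      (∫ x : ℝ, ‖ψ x‖ ^ 2) = 1 ∧
      (∫ x : ℝ, ‖-(deriv (deriv ψ) x) + Complex.I * (Real.sign x : ℂ) * ψ x
          - ((r : ℂ) + Complex.I * (s : ℂ)) * ψ x‖ ^ 2) ≤ η ^ 2 := by
  let φ : ContDiffBump (0 : ℝ) := ⟨1 / 2, 1, by norm_num, by norm_num⟩
  refine exists_wavePacket_residual_le φ.contDiff φ.hasCompactSupport
    (φ.pos_of_mem_ball (by simp [φ])).ne' (fun u hu => ?_) hr hs hη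
  have hu' : u ∈ Metric.ball (0 : ℝ) 1 := φ.support_eq ▸ Function.mem_support.2 hu
  simpa using hu'
end

section
/- The closure of the set { ∫_ℝ |ψ′(x)|² dx + i·∫_ℝ sgn(x)·|ψ(x)|² dx : ψ smooth compactly supported ℝ → ℂ with ∫_ℝ |ψ(x)|² dx = 1 } equals the closed half-strip {z ∈ ℂ : Re z ≥ 0 and |Im z| ≤ 1}. (This identifies the closure of the numerical range of H = −d²/dx² + i·sgn(x).) -/
open MeasureTheory Complex Set

/-- A smooth, compactly supported, nonzero profile supported in the open right half-line. -/
lemma exists_half_line_profile : ∃ f : ℝ → ℝ, ContDiff ℝ (⊤ : ℕ∞) f ∧ HasCompactSupport f ∧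
    (∀ x ≤ 0, f x = 0) ∧ (∀ x ≤ 0, deriv f x = 0) ∧
    0 < (∫ x, f x ^ 2) ∧ 0 < ∫ x, deriv f x ^ 2 := by
  let f : ContDiffBump (2 : ℝ) := ⟨1 / 2, 1, by norm_num, by norm_num⟩
  have hf : ContDiff ℝ (⊤ : ℕ∞) f := f.contDiff
  have hc : HasCompactSupport f := f.hasCompactSupport
  have hmem : ∀ x : ℝ, x ≤ 0 → x ∉ tsupport f := by
    intro x hx h
    rw [f.tsupport_eq, Metric.mem_closedBall, Real.dist_eq] at h
    have h' : |x - 2| ≤ 1 := h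
    linarith [(abs_le.mp h').1]
  have h0 : ∀ x ≤ 0, f x = 0 := fun x hx => image_eq_zero_of_notMem_tsupport (hmem x hx)
  have h0' : ∀ x ≤ 0, deriv f x = 0 := fun x hx => by
    by_contra h
    exact hmem x hx (support_deriv_subset h)
  have h2 : f 2 = 1 := f.one_of_mem_closedBall (Metric.mem_closedBall_self f.rIn_pos.le)
  have hd : Continuous (deriv f) := hf.continuous_deriv (by simp)
  have hpos : ∀ g : ℝ → ℝ, Continuous g → HasCompactSupport g → (∃ x, g x ≠ 0) →
      0 < ∫ x, g x ^ 2 := by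
    rintro g hg hgc ⟨x, hx⟩
    have hgc' : HasCompactSupport fun x => g x ^ 2 :=
      hgc.comp_left (g := fun y : ℝ => y ^ 2) (by simp)
    exact (hg.pow 2).integral_pos_of_hasCompactSupport_nonneg_nonzero hgc'
      (fun y => sq_nonneg (g y)) (pow_ne_zero 2 hx)
  refine ⟨f, hf, hc, h0, h0', hpos f hf.continuous hc ⟨2, by simp [h2]⟩, hpos _ hd hc.deriv ?_⟩
  by_contra! h
  have h20 := is_const_of_deriv_eq_zero (hf.differentiable (by simp)) h 2 0
  rw [h2, h0 0 le_rfl] at h20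
  exact one_ne_zero h20

lemma exists_wave_of_re_pos {a b : ℝ} (ha : 0 < a) (hb : |b| ≤ 1) :
    ∃ ψ : ℝ → ℂ, ContDiff ℝ (⊤ : ℕ∞) ψ ∧ HasCompactSupport ψ ∧ (∫ x : ℝ, ‖ψ x‖ ^ 2) = 1 ∧
      (∫ x : ℝ, ‖deriv ψ x‖ ^ 2) = a ∧ (∫ x : ℝ, Real.sign x * ‖ψ x‖ ^ 2) = b := by
  obtain ⟨f, hf, hc, h0, h0', hN, hK⟩ := exists_half_line_profile
  set N := ∫ x, f x ^ 2
  set K := ∫ x, deriv f x ^ 2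
  obtain ⟨hb1, hb2⟩ := abs_le.mp hb
  obtain ⟨l, hl, hl2⟩ : ∃ l : ℝ, 0 < l ∧ l ^ 2 = a * N / K :=
    ⟨√(a * N / K), by positivity, Real.sq_sqrt (by positivity)⟩
  obtain ⟨A, hA⟩ : ∃ A : ℝ, A ^ 2 = l * (1 + b) / (2 * N) :=
    ⟨_, Real.sq_sqrt (div_nonneg (mul_nonneg hl.le (by linarith)) (by positivity))⟩
  obtain ⟨B, hB⟩ : ∃ B : ℝ, B ^ 2 = l * (1 - b) / (2 * N) :=
    ⟨_, Real.sq_sqrt (div_nonneg (mul_nonneg hl.le (by linarith)) (by positivity))⟩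
  have hcsq : HasCompactSupport fun x => f x ^ 2 :=
    hc.comp_left (g := fun y : ℝ => y ^ 2) (by simp)
  have hcdsq : HasCompactSupport fun x => deriv f x ^ 2 :=
    hc.deriv.comp_left (g := fun y : ℝ => y ^ 2) (by simp)
  have hd : Continuous (deriv f) := hf.continuous_deriv (by simp)
  have hi : Integrable fun x => f x ^ 2 :=
    (hf.continuous.pow 2).integrable_of_hasCompactSupport hcsq
  have hid : Integrable fun x => deriv f x ^ 2 := (hd.pow 2).integrable_of_hasCompactSupport hcdsq
  have hint : ∀ (g : ℝ → ℝ), Integrable g → ∀ p q : ℝ,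
      (∫ x, (p * g (l * x) + q * g (-l * x))) = (p + q) / l * ∫ x, g x := by
    intro g hg p q
    rw [integral_add ((hg.comp_mul_left' hl.ne').const_mul p)
      ((hg.comp_mul_left' (neg_ne_zero.mpr hl.ne')).const_mul q), integral_const_mul,
      integral_const_mul, Measure.integral_comp_mul_left, Measure.integral_comp_mul_left,
      inv_neg, abs_neg, abs_of_pos (inv_pos.mpr hl)]
    simp only [smul_eq_mul]
    field_simp
  let φ : ℝ → ℝ := fun x => A * f (l * x) + B * f (-l * x)
  have hφ : ContDiff ℝ (⊤ : ℕ∞) φ := by fun_prop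
  have hφc : HasCompactSupport φ :=
    ((hc.comp_homeomorph (Homeomorph.mulLeft₀ l hl.ne')).mul_left (f := fun _ => A)).add
      ((hc.comp_homeomorph (Homeomorph.mulLeft₀ (-l) (neg_ne_zero.mpr hl.ne'))).mul_left
        (f := fun _ => B))
  have hdφ : ∀ x, HasDerivAt φ (A * (deriv f (l * x) * l) + B * (deriv f (-l * x) * -l)) x := by
    intro x
    have hfd : ∀ y, HasDerivAt f (deriv f y) y := fun y =>
      (hf.differentiable (by simp) y).hasDerivAt
    have hlin : ∀ m : ℝ, HasDerivAt (fun x : ℝ => m * x) m x := fun m => by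
      simpa using (hasDerivAt_id x).const_mul m
    exact (((hfd _).comp x (hlin l)).const_mul A).add (((hfd _).comp x (hlin (-l))).const_mul B)
  have hside : ∀ x : ℝ, l * x ≤ 0 ∨ -l * x ≤ 0 := fun x => by
    rcases le_total (l * x) 0 with h | h
    · exact Or.inl h
    · exact Or.inr (by linarith)
  have hsq : ∀ x, φ x ^ 2 = A ^ 2 * f (l * x) ^ 2 + B ^ 2 * f (-l * x) ^ 2 := fun x => by
    rcases hside x with h | h <;> simp only [φ, h0 _ h] <;> ring
  refine ⟨fun x => (φ x : ℂ), ofRealCLM.contDiff.comp hφ,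
    hφc.comp_left (g := ((↑) : ℝ → ℂ)) ofReal_zero, ?_, ?_, ?_⟩
  · simp only [norm_real, Real.norm_eq_abs, sq_abs, hsq]
    rw [hint (fun y => f y ^ 2) hi, hA, hB]
    change _ * N = 1
    field_simp
    ring
  · have hdsq : ∀ x, ‖deriv (fun x => (φ x : ℂ)) x‖ ^ 2 =
        A ^ 2 * l ^ 2 * deriv f (l * x) ^ 2 + B ^ 2 * l ^ 2 * deriv f (-l * x) ^ 2 := fun x => by
      rw [(hdφ x).ofReal_comp.deriv, norm_real, Real.norm_eq_abs, sq_abs]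
      rcases hside x with h | h <;> rw [h0' _ h] <;> ring
    simp only [hdsq]
    rw [hint (fun y => deriv f y ^ 2) hid, hA, hB, hl2]
    change _ * K = a
    field_simp
    ring
  · have hsgn : ∀ x, Real.sign x * ‖(φ x : ℂ)‖ ^ 2 =
        A ^ 2 * f (l * x) ^ 2 + -B ^ 2 * f (-l * x) ^ 2 := fun x => by
      rw [norm_real, Real.norm_eq_abs, sq_abs, hsq]
      rcases lt_trichotomy x 0 with h | rfl | h
      · rw [Real.sign_of_neg h, h0 (l * x) (by nlinarith)]
        ring
      · simp [h0]
      · rw [Real.sign_of_pos h, h0 (-l * x) (by nlinarith)]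
        ring
    simp only [hsgn]
    rw [hint (fun y => f y ^ 2) hi, hA, hB]
    change _ * N = b
    field_simp
    ring

lemma abs_integral_sign_mul_le {g : ℝ → ℝ} (hg : Integrable g) (h0 : ∀ x, 0 ≤ g x) :
    |∫ x, Real.sign x * g x| ≤ ∫ x, g x := by
  rw [← Real.norm_eq_abs]
  refine norm_integral_le_of_norm_le hg (Filter.Eventually.of_forall fun x => ?_)
  rw [norm_mul, Real.norm_of_nonneg (h0 x)]
  refine mul_le_of_le_one_left (h0 x) ?_
  rcases Real.sign_apply_eq x with h | h | h <;> simp [h]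

theorem stmt3 :
    closure {w : ℂ | ∃ ψ : ℝ → ℂ, ContDiff ℝ (⊤ : ℕ∞) ψ ∧ HasCompactSupport ψ ∧
        (∫ x : ℝ, ‖ψ x‖ ^ 2) = 1 ∧
        w = ((∫ x : ℝ, ‖deriv ψ x‖ ^ 2 : ℝ) : ℂ)
            + Complex.I * ((∫ x : ℝ, Real.sign x * ‖ψ x‖ ^ 2 : ℝ) : ℂ)} =
      {z : ℂ | 0 ≤ z.re ∧ |z.im| ≤ 1} := by
  apply Subset.antisymm
  · refine closure_minimal ?_ ((isClosed_le continuous_const continuous_re).inter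
      (isClosed_le continuous_im.abs continuous_const))
    rintro _ ⟨ψ, -, -, hnorm, rfl⟩
    have hi : Integrable fun x => ‖ψ x‖ ^ 2 := by
      by_contra h
      simp [integral_undef h] at hnorm
    have him := abs_integral_sign_mul_le hi fun x => sq_nonneg _
    rw [hnorm] at him
    refine ⟨?_, ?_⟩
    · simpa using integral_nonneg fun x => sq_nonneg ‖deriv ψ x‖
    · simpa using him
  · rintro z ⟨hre, him⟩
    refine Metric.mem_closure_iff.mpr fun ε hε => ?_
    obtain ⟨ψ, hψ, hc, hnorm, ha, hb⟩ :=
      exists_wave_of_re_pos (a := z.re + ε / 2) (by linarith) him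
    refine ⟨z + (ε / 2 : ℝ), ⟨ψ, hψ, hc, hnorm, ?_⟩, ?_⟩
    · rw [ha, hb]
      apply Complex.ext <;> simp
    · rw [dist_self_add_right, norm_real, Real.norm_of_nonneg (by linarith)]
      linarith
end

section
/- There exist constants C > 0 and τ₀ > 0 such that for every τ ≥ τ₀ and every δ ∈ (−1,1), writing z = τ + i·δ, one has |k₊(z) − i·√τ − (1−δ)/(2√τ)| ≤ C·τ^{−3/2} and |k₋(z) + i·√τ − (1+δ)/(2√τ)| ≤ C·τ^{−3/2}. -/
open MeasureTheory Complex Set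

theorem re_cpow_half_nonneg (x : ℂ) : 0 ≤ (x ^ (1/2 : ℂ)).re := by
  rcases eq_or_ne x 0 with rfl | hx
  · simp
  · rw [Complex.cpow_def_of_ne_zero hx, Complex.exp_re]
    have him : (Complex.log x * (1/2 : ℂ)).im = Complex.arg x / 2 := by
      rw [show (1/2 : ℂ) = ((1/2 : ℝ) : ℂ) by norm_num, Complex.im_mul_ofReal, Complex.log_im]
      ring
    rw [him]
    have h₁ := Complex.neg_pi_lt_arg x
    have h₂ := Complex.arg_le_pi x
    exact mul_nonneg (Real.exp_pos _).le
      (Real.cos_nonneg_of_neg_pi_div_two_le_of_le (by linarith) (by linarith))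

theorem cpow_half_sq (x : ℂ) : (x ^ (1/2 : ℂ)) ^ 2 = x := by
  rw [one_div, Complex.cpow_ofNat_inv_pow]

theorem norm_sub_sqrt_expansion_le {τ a : ℝ} (hτ : 0 < τ) (ha : |a| ≤ 2) {w : ℂ}
    (hw : w ^ 2 = -(τ : ℂ) + Complex.I * a) (him : 0 ≤ w.im) :
    ‖w - Complex.I * (Real.sqrt τ : ℂ) - ((a / (2 * Real.sqrt τ) : ℝ) : ℂ)‖
      ≤ 1 / (τ * Real.sqrt τ) := by
  have hs : 0 < Real.sqrt τ := Real.sqrt_pos.mpr hτ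
  have hss : Real.sqrt τ ^ 2 = τ := Real.sq_sqrt hτ.le
  set s := Real.sqrt τ
  have hsum : s ≤ ‖w + (Complex.I * (s : ℂ) + ((a / (2 * s) : ℝ) : ℂ))‖ := by
    have h := (le_abs_self _).trans
      (Complex.abs_im_le_norm (w + (Complex.I * (s : ℂ) + ((a / (2 * s) : ℝ) : ℂ))))
    rw [Complex.add_im, Complex.add_im, Complex.ofReal_im, Complex.I_mul_im,
      Complex.ofReal_re] at h
    linarith
  have hprod : (w - Complex.I * (s : ℂ) - ((a / (2 * s) : ℝ) : ℂ))
      * (w + (Complex.I * (s : ℂ) + ((a / (2 * s) : ℝ) : ℂ)))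
      = ((-(a ^ 2 / (4 * τ)) : ℝ) : ℂ) := by
    have hs' : (s : ℂ) ≠ 0 := by exact_mod_cast hs.ne'
    have hτs : (τ : ℂ) = (s : ℂ) ^ 2 := by exact_mod_cast hss.symm
    have hq : (s : ℂ) * ((a : ℂ) / (2 * s)) = a / 2 := by field_simp
    have hq2 : ((a : ℂ) / (2 * s)) ^ 2 = a ^ 2 / (4 * s ^ 2) := by field_simp; norm_num
    push_cast
    rw [hτs] at hw ⊢
    linear_combination hw - (s : ℂ) ^ 2 * Complex.I_sq - 2 * Complex.I * hq - hq2
  have hnorm := congrArg norm hprod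
  rw [norm_mul, Complex.norm_real, Real.norm_eq_abs, abs_neg,
    abs_of_nonneg (by positivity)] at hnorm
  have ha2 : a ^ 2 ≤ 4 := by
    rw [← sq_abs]
    nlinarith [abs_nonneg a]
  have hbound : a ^ 2 / (4 * τ) ≤ 1 / τ := by
    rw [div_le_div_iff₀ (by positivity) hτ]
    nlinarith
  have hmul := mul_le_mul_of_nonneg_left hsum
    (norm_nonneg (w - Complex.I * (s : ℂ) - ((a / (2 * s) : ℝ) : ℂ)))
  rw [hnorm] at hmul
  rw [← div_div 1 τ s, le_div_iff₀ hs]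
  exact hmul.trans hbound

theorem im_nonneg_of_sq_im_pos {w : ℂ} (hre : 0 ≤ w.re) (h : 0 < (w ^ 2).im) : 0 ≤ w.im := by
  rw [sq, Complex.mul_im] at h
  by_contra! hneg
  nlinarith [mul_nonneg hre (neg_nonneg.mpr hneg.le)]

theorem im_nonpos_of_sq_im_neg {w : ℂ} (hre : 0 ≤ w.re) (h : (w ^ 2).im < 0) : w.im ≤ 0 := by
  rw [sq, Complex.mul_im] at h
  by_contra! hpos
  nlinarith [mul_nonneg hre hpos.le]

theorem stmt4 : ∃ C : ℝ, 0 < C ∧ ∃ τ₀ : ℝ, 0 < τ₀ ∧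
    ∀ τ : ℝ, τ₀ ≤ τ → ∀ δ : ℝ, -1 < δ → δ < 1 →
      ‖kp ((τ : ℂ) + Complex.I * (δ : ℂ)) - Complex.I * (Real.sqrt τ : ℂ)
          - (((1 - δ) / (2 * Real.sqrt τ) : ℝ) : ℂ)‖ ≤ C / (τ * Real.sqrt τ) ∧
      ‖km ((τ : ℂ) + Complex.I * (δ : ℂ)) + Complex.I * (Real.sqrt τ : ℂ)
          - (((1 + δ) / (2 * Real.sqrt τ) : ℝ) : ℂ)‖ ≤ C / (τ * Real.sqrt τ) := by
  refine ⟨1, one_pos, 1, one_pos, fun τ hτ δ hδ₁ hδ₂ => ⟨?_, ?_⟩⟩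
  · have hsq : kp ((τ : ℂ) + Complex.I * (δ : ℂ)) ^ 2
        = -(τ : ℂ) + Complex.I * ((1 - δ : ℝ) : ℂ) := by
      rw [kp, cpow_half_sq]
      push_cast
      ring
    refine norm_sub_sqrt_expansion_le (by linarith)
      (abs_le.mpr ⟨by linarith, by linarith⟩) hsq
      (im_nonneg_of_sq_im_pos (re_cpow_half_nonneg _) ?_)
    rw [hsq, Complex.add_im, Complex.neg_im, Complex.ofReal_im, Complex.I_mul_im,
      Complex.ofReal_re]
    linarith
  · have hsq : km ((τ : ℂ) + Complex.I * (δ : ℂ)) ^ 2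
        = -(τ : ℂ) + Complex.I * ((-(1 + δ) : ℝ) : ℂ) := by
      rw [km, cpow_half_sq]
      push_cast
      ring
    have him : (km ((τ : ℂ) + Complex.I * (δ : ℂ))).im ≤ 0 := by
      refine im_nonpos_of_sq_im_neg (re_cpow_half_nonneg _) ?_
      rw [hsq, Complex.add_im, Complex.neg_im, Complex.ofReal_im, Complex.I_mul_im,
        Complex.ofReal_re]
      linarith
    have h := norm_sub_sqrt_expansion_le (by linarith : 0 < τ)
      (abs_le.mpr ⟨by linarith, by linarith⟩) ((neg_sq _).trans hsq)
      (by rw [Complex.neg_im]; linarith)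
    rw [← norm_neg] at h
    refine le_of_eq_of_le (congrArg norm ?_) h
    push_cast
    ring
end

section
/- For every z ∈ ℂ∖Σ one has sup_{x∈ℝ} ∫_ℝ |R_z(x,ξ)|² dξ < ∞; that is, the map x ↦ R_z(x,·) belongs to L^∞(ℝ; L²(ℝ)). -/
open MeasureTheory Complex Set

theorem re_cpow_half_pos {w : ℂ} (hw : w ∈ slitPlane) : 0 < (w ^ (1 / 2 : ℂ)).re := by
  obtain ⟨harg, hw0⟩ := mem_slitPlane_iff_arg.1 hw
  have h1 := neg_pi_lt_arg w
  have h2 := lt_of_le_of_ne (arg_le_pi w) harg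
  rw [cpow_def_of_ne_zero hw0, exp_re]
  refine mul_pos (Real.exp_pos _) (Real.cos_pos_of_mem_Ioo ?_)
  have him : (log w * (1 / 2 : ℂ)).im = arg w / 2 := by
    rw [mul_one_div, div_ofNat_im, log_im]
  rw [him]
  constructor <;> linarith

theorem re_kp_pos {z : ℂ} (hz : z ∉ SigmaSet) : 0 < (kp z).re := by
  refine re_cpow_half_pos (mem_slitPlane_iff.2 ?_)
  by_contra! h
  simp only [sub_re, I_re, sub_im, I_im] at h
  exact hz ⟨by linarith [h.1], Or.inl (by linarith [h.2])⟩

theorem re_km_pos {z : ℂ} (hz : z ∉ SigmaSet) : 0 < (km z).re := by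
  refine re_cpow_half_pos (mem_slitPlane_iff.2 ?_)
  by_contra! h
  simp only [sub_re, neg_re, I_re, sub_im, neg_im, I_im] at h
  exact hz ⟨by linarith [h.1], Or.inr (by linarith [h.2])⟩

theorem norm_exp_mul_div_le {u c d : ℂ} {r : ℝ} (h : u.re ≤ r) :
    ‖c * exp u / d‖ ≤ ‖c / d‖ * Real.exp r := by
  rw [mul_div_right_comm, norm_mul, norm_exp]
  gcongr

theorem norm_exp_div_le {u d : ℂ} {r : ℝ} (h : u.re ≤ r) :
    ‖exp u / d‖ ≤ ‖1 / d‖ * Real.exp r := by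
  simpa using norm_exp_mul_div_le (c := 1) (d := d) h

theorem exists_norm_Rker_le (z : ℂ) (hz : z ∉ SigmaSet) :
    ∃ A a : ℝ, 0 < a ∧ ∀ x y : ℝ, ‖Rker z x y‖ ≤ A * Real.exp (-a * |y - x|) := by
  obtain ⟨a, ha, hap, ham⟩ : ∃ a : ℝ, 0 < a ∧ a ≤ (kp z).re ∧ a ≤ (km z).re :=
    ⟨min (kp z).re (km z).re, lt_min (re_kp_pos hz) (re_km_pos hz), min_le_left _ _,
      min_le_right _ _⟩
  refine ⟨‖1 / (kp z + km z)‖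
    + (‖1 / (2 * kp z)‖ + ‖(kp z - km z) / (2 * kp z * (kp z + km z))‖)
    + (‖1 / (2 * km z)‖ + ‖(kp z - km z) / (2 * km z * (kp z + km z))‖), a, ha, fun x y => ?_⟩
  have hE := (Real.exp_pos (-a * |y - x|)).le
  have h1 := mul_nonneg (norm_nonneg (1 / (kp z + km z))) hE
  have h2 := mul_nonneg (norm_nonneg (1 / (2 * kp z))) hE
  have h3 := mul_nonneg (norm_nonneg ((kp z - km z) / (2 * kp z * (kp z + km z)))) hE
  have h4 := mul_nonneg (norm_nonneg (1 / (2 * km z))) hE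
  have h5 := mul_nonneg (norm_nonneg ((kp z - km z) / (2 * km z * (kp z + km z)))) hE
  simp only [add_mul]
  unfold Rker
  split_ifs with hc1 hc2 hc3
  · obtain ⟨hx, hy⟩ := hc1
    refine (norm_exp_div_le (r := -a * |y - x|) ?_).trans (by linarith)
    rw [abs_of_nonpos (by linarith)]
    simp only [add_re, neg_mul, neg_re, re_mul_ofReal]
    nlinarith [mul_nonneg (sub_nonneg.2 hap) hx,
      mul_nonneg (sub_nonneg.2 ham) (neg_nonneg.2 hy)]
  · obtain ⟨hx, hy⟩ := hc2
    refine (norm_exp_div_le (r := -a * |y - x|) ?_).trans (by linarith)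
    rw [abs_of_nonneg (by linarith)]
    simp only [sub_re, re_mul_ofReal]
    nlinarith [mul_nonneg (sub_nonneg.2 hap) hy,
      mul_nonneg (sub_nonneg.2 ham) (neg_nonneg.2 hx)]
  · have hy : 0 ≤ y := by
      by_contra! h
      exact hc1 ⟨hc3, h.le⟩
    refine (norm_add_le_of_le (norm_exp_div_le (r := -a * |y - x|) ?_)
      (norm_exp_mul_div_le (r := -a * |y - x|) ?_)).trans (by linarith)
    · rw [abs_sub_comm y x, re_mul_ofReal, neg_re]
      gcongr
    · rw [← ofReal_add, re_mul_ofReal, neg_re]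
      have hxy : |y - x| ≤ x + y := abs_le.2 ⟨by linarith, by linarith⟩
      nlinarith [mul_nonneg (sub_nonneg.2 hap) (add_nonneg hc3 hy),
        mul_nonneg ha.le (sub_nonneg.2 hxy)]
  · have hx : 0 ≤ -x := by linarith
    have hy : 0 ≤ -y := by
      by_contra! h
      exact hc2 ⟨by linarith, by linarith⟩
    refine (norm_sub_le_of_le (norm_exp_div_le (r := -a * |y - x|) ?_)
      (norm_exp_mul_div_le (r := -a * |y - x|) ?_)).trans (by linarith)
    · rw [abs_sub_comm y x, re_mul_ofReal, neg_re]
      gcongr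
    · rw [← ofReal_add, re_mul_ofReal]
      have hxy : |y - x| ≤ -x + -y := abs_le.2 ⟨by linarith, by linarith⟩
      nlinarith [mul_nonneg (sub_nonneg.2 ham) (add_nonneg hx hy),
        mul_nonneg ha.le (sub_nonneg.2 hxy)]

theorem integrable_exp_neg_mul_abs {b : ℝ} (hb : 0 < b) :
    Integrable fun t : ℝ => Real.exp (-b * |t|) := by
  rw [← integrableOn_univ, ← Iic_union_Ioi (a := (0 : ℝ))]
  refine IntegrableOn.union ?_ ?_
  · refine (integrableOn_exp_mul_Iic hb 0).congr_fun (fun t ht => ?_) measurableSet_Iic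
    simp [abs_of_nonpos (mem_Iic.1 ht)]
  · refine (integrableOn_exp_mul_Ioi (neg_lt_zero.2 hb) 0).congr_fun (fun t ht => ?_)
      measurableSet_Ioi
    simp [abs_of_pos (mem_Ioi.1 ht)]

theorem stmt9 (z : ℂ) (hz : z ∉ SigmaSet) :
    ∃ C : ℝ, ∀ x : ℝ, (∫ ξ : ℝ, ‖Rker z x ξ‖ ^ 2) ≤ C := by
  obtain ⟨A, a, ha, hA⟩ := exists_norm_Rker_le z hz
  have hint : Integrable fun t : ℝ => A ^ 2 * Real.exp (-(2 * a) * |t|) :=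
    (integrable_exp_neg_mul_abs (by positivity)).const_mul _
  refine ⟨∫ t : ℝ, A ^ 2 * Real.exp (-(2 * a) * |t|), fun x => ?_⟩
  rw [← integral_sub_right_eq_self (fun t : ℝ => A ^ 2 * Real.exp (-(2 * a) * |t|)) x]
  refine integral_mono_of_nonneg (.of_forall fun ξ => by positivity) (hint.comp_sub_right x)
    (.of_forall fun ξ => ?_)
  calc ‖Rker z x ξ‖ ^ 2 ≤ (A * Real.exp (-a * |ξ - x|)) ^ 2 := by
        gcongr
        exact hA x ξ
    _ = A ^ 2 * Real.exp (-(2 * a) * |ξ - x|) := by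
        rw [mul_pow, ← Real.exp_nat_mul]
        congr 2
        push_cast
        ring
end

section
/- There exists a constant C > 0 such that for every z ∈ ℂ∖Σ and every (x,y) ∈ ℝ², one has |R^D_z(x,y)| ≤ C·(1 + |x| + |y|). -/
open MeasureTheory Complex Set

noncomputable def RkerD (z : ℂ) (x y : ℝ) : ℂ :=
  if 0 < x ∧ 0 < y then
    (Complex.exp (-(kp z) * (|x - y| : ℝ)) - Complex.exp (-(kp z) * ((|x| : ℝ) + (|y| : ℝ)))) / (2 * kp z)
  else if x < 0 ∧ y < 0 then
    (Complex.exp (-(km z) * (|x - y| : ℝ)) - Complex.exp (-(km z) * ((|x| : ℝ) + (|y| : ℝ)))) / (2 * km z)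
  else 0

theorem Complex.cpow_half_re_nonneg (w : ℂ) : 0 ≤ (w ^ (1/2 : ℂ)).re := by
  rcases eq_or_ne w 0 with rfl | hw
  · simp
  have him : (Complex.log w * (1/2 : ℂ)).im = w.arg / 2 := by
    have : (1/2 : ℂ) = ((1/2 : ℝ) : ℂ) := by norm_num
    rw [this, Complex.im_mul_ofReal, Complex.log_im]
    ring
  rw [Complex.cpow_def_of_ne_zero hw, Complex.exp_re, him]
  have h₁ := Complex.neg_pi_lt_arg w
  have h₂ := Complex.arg_le_pi w
  exact mul_nonneg (Real.exp_pos _).le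
    (Real.cos_nonneg_of_neg_pi_div_two_le_of_le (by linarith) (by linarith))

theorem Complex.norm_exp_sub_exp_le_of_re_nonpos {u v : ℂ} (hu : u.re ≤ 0) (hv : v.re ≤ 0) :
    ‖Complex.exp u - Complex.exp v‖ ≤ ‖u - v‖ := by
  have h := (convex_halfSpace_re_le 0).norm_image_sub_le_of_norm_deriv_le
    (f := Complex.exp) (C := 1) (fun _ _ => Complex.differentiableAt_exp)
    (fun w hw => by
      rw [Complex.deriv_exp, Complex.norm_exp]
      exact Real.exp_le_one_iff.mpr hw) hv hu
  simpa using h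

/-- The bound also holds for `k = 0`, where the quotient is zero by convention. -/
theorem norm_exp_sub_exp_div_le {k : ℂ} (hk : 0 ≤ k.re) {a b : ℝ} (ha : 0 ≤ a) (hab : a ≤ b) :
    ‖(Complex.exp (-k * a) - Complex.exp (-k * b)) / (2 * k)‖ ≤ (b - a) / 2 := by
  rcases eq_or_ne k 0 with rfl | hk0
  · simpa using div_nonneg (sub_nonneg.mpr hab) zero_le_two
  have hre : ∀ t : ℝ, 0 ≤ t → (-k * t).re ≤ 0 := fun t ht => by
    rw [Complex.re_mul_ofReal, Complex.neg_re]
    nlinarith [mul_nonneg hk ht]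
  have h := Complex.norm_exp_sub_exp_le_of_re_nonpos (hre a ha) (hre b (ha.trans hab))
  have hsub : -k * a - -k * b = k * ((b - a : ℝ) : ℂ) := by
    push_cast
    ring
  rw [hsub, norm_mul, Complex.norm_real, Real.norm_of_nonneg (sub_nonneg.mpr hab)] at h
  have hpos : 0 < ‖k‖ := norm_pos_iff.mpr hk0
  rw [norm_div, norm_mul, Complex.norm_two, div_le_iff₀ (by positivity)]
  linarith

theorem norm_dirichlet_halfLine_kernel_le {k : ℂ} (hk : 0 ≤ k.re) (x y : ℝ) :
    ‖(Complex.exp (-k * (|x - y| : ℝ)) - Complex.exp (-k * ((|x| : ℝ) + (|y| : ℝ)))) / (2 * k)‖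
      ≤ 1 + |x| + |y| := by
  have h := norm_exp_sub_exp_div_le hk (abs_nonneg (x - y)) (abs_sub x y)
  rw [Complex.ofReal_add] at h
  linarith [abs_nonneg x, abs_nonneg y, abs_nonneg (x - y)]

theorem stmt18 : ∃ C : ℝ, 0 < C ∧ ∀ z : ℂ, z ∉ SigmaSet → ∀ x y : ℝ,
    ‖RkerD z x y‖ ≤ C * (1 + |x| + |y|) := by
  refine ⟨1, one_pos, fun z _ x y => ?_⟩
  rw [one_mul, RkerD]
  split_ifs
  · exact norm_dirichlet_halfLine_kernel_le (Complex.cpow_half_re_nonneg _) x y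
  · exact norm_dirichlet_halfLine_kernel_le (Complex.cpow_half_re_nonneg _) x y
  · rw [norm_zero]
    positivity
end
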